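/- arXiv:2408.12857 — 7 statements merged into one kernel-verified Lean document; each statement's English description precedes it below -/
import Mathlib

section
/- Let E be a finite-dimensional real inner product space, let L : E → ℝ be differentiable, and let a > 0. Suppose W, M : ℝ → E are differentiable curves satisfying the continuous-time momentum dynamics W'(t) = −M(t) and M'(t) = a(∇L(W(t)) − M(t)). Define H(W, M) = L(W) + ‖M‖²/(2a). Then for all t, (d/dt) H(W(t), M(t)) = −‖M(t)‖² ≤ 0. -/
/-- **Momentum method is Hamiltonian descent.**
For differentiable `L` on a finite-dimensional real inner product space and `a > 0`,
any solution of `W' = −M`, `M' = a(∇L(W) − M)` satisfies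
`d/dt [L(W t) + ‖M t‖²/(2a)] = −‖M t‖² ≤ 0`. -/
theorem momentum_hamiltonian_descent
    {E : Type*} [NormedAddCommGroup E] [InnerProductSpace ℝ E] [FiniteDimensional ℝ E]
    (L : E → ℝ) (hL : Differentiable ℝ L)
    (a : ℝ) (ha : 0 < a)
    (W M : ℝ → E)
    (hW : ∀ t : ℝ, HasDerivAt W (-(M t)) t)
    (hM : ∀ t : ℝ, HasDerivAt M (a • (gradient L (W t) - M t)) t) :
    ∀ t : ℝ,
      HasDerivAt (fun s : ℝ => L (W s) + ‖M s‖ ^ 2 / (2 * a)) (-‖M t‖ ^ 2) t ∧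
      -‖M t‖ ^ 2 ≤ 0 := by
  intro t
  refine ⟨?_, neg_nonpos.mpr (sq_nonneg _)⟩
  have hLW : HasDerivAt (fun s => L (W s)) (inner ℝ (gradient L (W t)) (-(M t))) t := by
    exact (hL (W t)).hasGradientAt.hasFDerivAt.comp_hasDerivAt t (hW t)
  refine (hLW.add ((hM t).norm_sq.div_const (2 * a))).congr_deriv ?_
  rw [inner_neg_right, inner_smul_right, inner_sub_right, real_inner_self_eq_norm_sq,
    real_inner_comm (M t)]
  field_simp
  ring
end

section
/- Let E be a finite-dimensional real inner product space, let L : E → ℝ be differentiable, let K : E → ℝ be convex and differentiable with ∇K(0) = 0, let a ≥ 0 and b ∈ [0, 1). Suppose W, M : ℝ → E are differentiable curves satisfying the continuous-time Lion-K dynamics W'(t) = ∇K((1−b)M(t) − b∇L(W(t))) and M'(t) = −a(∇L(W(t)) + M(t)). Define H(W, M) = a·L(W) + (1/(1−b))·K((1−b)M). Then for all t, (d/dt) H(W(t), M(t)) ≤ 0. -/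
open scoped RealInnerProductSpace in
/-- The gradient of a differentiable function along a differentiable curve. -/
theorem HasDerivAt.comp_inner_gradient {E : Type*} [NormedAddCommGroup E]
    [InnerProductSpace ℝ E] [CompleteSpace E] {f : E → ℝ} {γ : ℝ → E} {v : E} {t : ℝ}
    (hf : DifferentiableAt ℝ f (γ t)) (hγ : HasDerivAt γ v t) :
    HasDerivAt (fun s => f (γ s)) ⟪gradient f (γ t), v⟫ t := by
  exact hf.hasGradientAt.hasFDerivAt.comp_hasDerivAt t hγ

open scoped RealInnerProductSpace in
/-- The gradient of a differentiable convex function is a monotone operator. -/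
theorem ConvexOn.inner_gradient_sub_nonneg {E : Type*} [NormedAddCommGroup E]
    [InnerProductSpace ℝ E] [CompleteSpace E] {f : E → ℝ} (hf : ConvexOn ℝ Set.univ f)
    (hd : Differentiable ℝ f) (x y : E) :
    0 ≤ ⟪gradient f y - gradient f x, y - x⟫ := by
  have hderiv (s : ℝ) : HasDerivAt (fun r => f (AffineMap.lineMap x y r))
      ⟪gradient f (AffineMap.lineMap x y s), y - x⟫ s :=
    HasDerivAt.comp_inner_gradient (hd _) AffineMap.hasDerivAt_lineMap
  have hconv : ConvexOn ℝ Set.univ (fun r : ℝ => f (AffineMap.lineMap x y r)) :=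
    hf.comp_affineMap (AffineMap.lineMap x y)
  have hmono := hconv.monotoneOn_deriv (fun s _ => (hderiv s).differentiableAt)
    (Set.mem_univ 0) (Set.mem_univ 1) zero_le_one
  rw [(hderiv 0).deriv, (hderiv 1).deriv, AffineMap.lineMap_apply_zero,
    AffineMap.lineMap_apply_one] at hmono
  rw [inner_sub_left]
  linarith

/-- **Continuous-time Lion-𝒦 is Hamiltonian descent.**
For differentiable `L`, convex differentiable `K` with `∇K(0) = 0`, `a ≥ 0`, `b ∈ [0,1)`,
any solution of `W' = ∇K((1−b)M − b∇L(W))`, `M' = −a(∇L(W) + M)` makes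
`H(W,M) = a L(W) + K((1−b)M)/(1−b)` non-increasing: `d/dt H(W t, M t) ≤ 0`. -/
theorem lionK_hamiltonian_descent
    {E : Type*} [NormedAddCommGroup E] [InnerProductSpace ℝ E] [FiniteDimensional ℝ E]
    (L : E → ℝ) (hL : Differentiable ℝ L)
    (K : E → ℝ) (hKconv : ConvexOn ℝ Set.univ K) (hKdiff : Differentiable ℝ K)
    (hK0 : gradient K 0 = 0)
    (a b : ℝ) (ha : 0 ≤ a) (hb0 : 0 ≤ b) (hb1 : b < 1)
    (W M : ℝ → E)
    (hW : ∀ t : ℝ, HasDerivAt W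
      (gradient K ((1 - b) • M t - b • gradient L (W t))) t)
    (hM : ∀ t : ℝ, HasDerivAt M (-(a • (gradient L (W t) + M t))) t) :
    ∀ t : ℝ,
      ∃ d : ℝ,
        HasDerivAt (fun s : ℝ => a * L (W s) + (1 / (1 - b)) * K ((1 - b) • M s)) d t ∧
        d ≤ 0 := by
  intro t
  have hc : 0 < 1 - b := sub_pos.2 hb1
  set g := gradient L (W t)
  set P := gradient K ((1 - b) • M t - b • g) with hP
  set Q := gradient K ((1 - b) • M t) with hQ
  have hLW := HasDerivAt.comp_inner_gradient (hL (W t)) (hW t)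
  have hKM := HasDerivAt.comp_inner_gradient (f := K) (hKdiff _) ((hM t).const_smul (1 - b))
  refine ⟨_, (hLW.const_mul a).add (hKM.const_mul (1 / (1 - b))), ?_⟩
  have hQM : 0 ≤ inner ℝ Q (M t) := by
    have h := hKconv.inner_gradient_sub_nonneg hKdiff 0 ((1 - b) • M t)
    rw [hK0, sub_zero, sub_zero, real_inner_smul_right] at h
    exact nonneg_of_mul_nonneg_right h hc
  have hPQ : inner ℝ P g ≤ inner ℝ Q g := by
    rcases hb0.eq_or_lt with rfl | hb
    · simp [hP, hQ]
    · have h := hKconv.inner_gradient_sub_nonneg hKdiff ((1 - b) • M t - b • g) ((1 - b) • M t)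
      rw [sub_sub_cancel, real_inner_smul_right, inner_sub_left] at h
      exact sub_nonneg.1 (nonneg_of_mul_nonneg_right h hb)
  calc a * inner ℝ g P
        + 1 / (1 - b) * inner ℝ Q ((1 - b) • -(a • (g + M t)))
      = a * (inner ℝ P g - inner ℝ Q g - inner ℝ Q (M t)) := by
        rw [real_inner_smul_right, inner_neg_right, real_inner_smul_right, inner_add_right,
          real_inner_comm g P]
        field_simp
        ring
    _ ≤ 0 := mul_nonpos_of_nonneg_of_nonpos ha (by linarith)
end

section
/- Let n, m, k be positive integers, let H : ℝ^{n×m} × ℝ^{k×m} → ℝ be continuously differentiable, and let Φ : ℝ^{n×m} → ℝ^{n×m}, Ψ : ℝ^{k×m} → ℝ^{k×m} satisfy ⟨X, Φ(X)⟩ ≥ 0 and ⟨Y, Ψ(Y)⟩ ≥ 0 for all X, Y. Let P : ℝ → ℝ^{n×k} be an arbitrary function, and suppose W : ℝ → ℝ^{n×m} and Ŝ : ℝ → ℝ^{k×m} are differentiable curves satisfying W'(t) = P(t)·∂_Ŝ H(W(t), Ŝ(t)) − Φ(∂_W H(W(t), Ŝ(t))) and Ŝ'(t) = −P(t)ᵀ·∂_W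 H(W(t), Ŝ(t)) − Ψ(∂_Ŝ H(W(t), Ŝ(t))). Then for all t, regardless of P, (d/dt) H(W(t), Ŝ(t)) = −⟨∂_W H, Φ(∂_W H)⟩ − ⟨∂_Ŝ H, Ψ(∂_Ŝ H)⟩ ≤ 0, where the partial gradients are evaluated at (W(t), Ŝ(t)). -/
namespace Stmt4

open Matrix

attribute [local instance] Matrix.frobeniusNormedAddCommGroup Matrix.frobeniusNormedSpace

/-- Frobenius inner product `⟨A, B⟩ = trace(Aᵀ B)` of real matrices. -/
def finner {p q : ℕ} (A B : Matrix (Fin p) (Fin q) ℝ) : ℝ := (Aᵀ * B).trace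

lemma finner_comm {p q : ℕ} (A B : Matrix (Fin p) (Fin q) ℝ) : finner A B = finner B A := by
  rw [finner, finner, ← trace_transpose, transpose_mul, transpose_transpose]

lemma finner_sub_right {p q : ℕ} (A B C : Matrix (Fin p) (Fin q) ℝ) :
    finner A (B - C) = finner A B - finner A C := by
  simp only [finner, Matrix.mul_sub, trace_sub]

lemma finner_neg_right {p q : ℕ} (A B : Matrix (Fin p) (Fin q) ℝ) :
    finner A (-B) = -finner A B := by
  simp only [finner, Matrix.mul_neg, trace_neg]

/-- Left multiplication by `Pᵀ` is adjoint to left multiplication by `P`. -/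
lemma finner_mul_right {p q r : ℕ} (A : Matrix (Fin p) (Fin q) ℝ)
    (P : Matrix (Fin p) (Fin r) ℝ) (B : Matrix (Fin r) (Fin q) ℝ) :
    finner A (P * B) = finner (Pᵀ * A) B := by
  simp only [finner, transpose_mul, transpose_transpose, Matrix.mul_assoc]

/-- Chain rule along a curve in a product, in terms of partial Fréchet derivatives. -/
lemma hasDerivAt_comp_prodMk_of_differentiableAt {E F G : Type*}
    [NormedAddCommGroup E] [NormedSpace ℝ E] [NormedAddCommGroup F] [NormedSpace ℝ F]
    [NormedAddCommGroup G] [NormedSpace ℝ G] {f : E × F → G} {u : ℝ → E} {v : ℝ → F}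
    {u' : E} {v' : F} {t : ℝ} (hf : DifferentiableAt ℝ f (u t, v t))
    (hu : HasDerivAt u u' t) (hv : HasDerivAt v v' t) :
    HasDerivAt (fun s => f (u s, v s))
      (fderiv ℝ (fun x => f (x, v t)) (u t) u' + fderiv ℝ (fun y => f (u t, y)) (v t) v') t := by
  have h₁ := (HasFDerivAt.comp (u t) hf.hasFDerivAt
    (hasFDerivAt_prodMk_left (𝕜 := ℝ) (u t) (v t))).fderiv
  have h₂ := (HasFDerivAt.comp (v t) hf.hasFDerivAt
    (hasFDerivAt_prodMk_right (𝕜 := ℝ) (u t) (v t))).fderiv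
  simp only [Function.comp_def] at h₁ h₂
  rw [h₁, h₂]
  refine (hf.hasFDerivAt.comp_hasDerivAt t (hu.prodMk hv)).congr_deriv ?_
  simp [← map_add]

/-- **Online subspace descent preserves the Hamiltonian+descent structure.**
For continuously differentiable `H : ℝ^{n×m} × ℝ^{k×m} → ℝ` with partial Frobenius
gradients `∂_W H` and `∂_Ŝ H`, descent maps `Φ, Ψ` with nonnegative pairings, and an
*arbitrary* projection curve `P : ℝ → ℝ^{n×k}`, any solution of
`W' = P ∂_Ŝ H − Φ(∂_W H)`, `Ŝ' = −Pᵀ ∂_W H − Ψ(∂_Ŝ H)` satisfies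
`d/dt H(W t, Ŝ t) = −⟨∂_W H, Φ(∂_W H)⟩ − ⟨∂_Ŝ H, Ψ(∂_Ŝ H)⟩ ≤ 0`, regardless of `P`. -/
theorem online_subspace_descent_hamiltonian
    {n m k : ℕ} (hn : 0 < n) (hm : 0 < m) (hk : 0 < k)
    (H : Matrix (Fin n) (Fin m) ℝ × Matrix (Fin k) (Fin m) ℝ → ℝ) (hH : ContDiff ℝ 1 H)
    (Φ : Matrix (Fin n) (Fin m) ℝ → Matrix (Fin n) (Fin m) ℝ)
    (Ψ : Matrix (Fin k) (Fin m) ℝ → Matrix (Fin k) (Fin m) ℝ)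
    (hΦ : ∀ X : Matrix (Fin n) (Fin m) ℝ, 0 ≤ finner X (Φ X))
    (hΨ : ∀ Y : Matrix (Fin k) (Fin m) ℝ, 0 ≤ finner Y (Ψ Y))
    -- partial gradients of `H` w.r.t. its first and second arguments
    (gW : Matrix (Fin n) (Fin m) ℝ → Matrix (Fin k) (Fin m) ℝ → Matrix (Fin n) (Fin m) ℝ)
    (gS : Matrix (Fin n) (Fin m) ℝ → Matrix (Fin k) (Fin m) ℝ → Matrix (Fin k) (Fin m) ℝ)
    (hgW : ∀ (W : Matrix (Fin n) (Fin m) ℝ) (S : Matrix (Fin k) (Fin m) ℝ)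
      (X : Matrix (Fin n) (Fin m) ℝ),
      fderiv ℝ (fun W' => H (W', S)) W X = finner (gW W S) X)
    (hgS : ∀ (W : Matrix (Fin n) (Fin m) ℝ) (S : Matrix (Fin k) (Fin m) ℝ)
      (Y : Matrix (Fin k) (Fin m) ℝ),
      fderiv ℝ (fun S' => H (W, S')) S Y = finner (gS W S) Y)
    (P : ℝ → Matrix (Fin n) (Fin k) ℝ)
    (W : ℝ → Matrix (Fin n) (Fin m) ℝ) (S : ℝ → Matrix (Fin k) (Fin m) ℝ)
    (hW : ∀ t : ℝ, HasDerivAt W (P t * gS (W t) (S t) - Φ (gW (W t) (S t))) t)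
    (hS : ∀ t : ℝ, HasDerivAt S (-((P t)ᵀ * gW (W t) (S t)) - Ψ (gS (W t) (S t))) t) :
    ∀ t : ℝ,
      HasDerivAt (fun s : ℝ => H (W s, S s))
        (-finner (gW (W t) (S t)) (Φ (gW (W t) (S t)))
          - finner (gS (W t) (S t)) (Ψ (gS (W t) (S t)))) t ∧
      -finner (gW (W t) (S t)) (Φ (gW (W t) (S t)))
          - finner (gS (W t) (S t)) (Ψ (gS (W t) (S t))) ≤ 0 := by
  intro t
  refine ⟨?_, by linarith [hΦ (gW (W t) (S t)), hΨ (gS (W t) (S t))]⟩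
  have h := hasDerivAt_comp_prodMk_of_differentiableAt
    (hH.differentiable one_ne_zero (W t, S t)) (hW t) (hS t)
  refine h.congr_deriv ((congrArg₂ (· + ·) (hgW _ _ _) (hgS _ _ _)).trans ?_)
  simp only [finner_sub_right, finner_neg_right, finner_mul_right,
    transpose_transpose]
  rw [finner_comm (P t * _), finner_mul_right]
  ring

end Stmt4
end

section
/- Let n, m, k be positive integers, let L : ℝ^{n×m} → ℝ be differentiable, and let a > 0. Let P : ℝ → ℝ^{n×k} be an arbitrary function, and suppose W : ℝ → ℝ^{n×m} and m̂ : ℝ → ℝ^{k×m} are differentiable curves satisfying the momentum-with-online-subspace-descent dynamics W'(t) = −P(t)·m̂(t) and m̂'(t) = a(P(t)ᵀ·∇L(W(t)) − m̂(t)). Define H(W, m̂) = L(W) + ‖m̂‖²/(2a). Then for all t, (d/dt) H(W(t), m̂(t)) = −‖m̂(t)‖² ≤ 0. -/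
namespace Stmt5

open Matrix

attribute [local instance] Matrix.frobeniusNormedAddCommGroup Matrix.frobeniusNormedSpace

/-- Frobenius inner product `⟨A, B⟩ = trace(Aᵀ B)` of real matrices. -/
def finner {p q : ℕ} (A B : Matrix (Fin p) (Fin q) ℝ) : ℝ := (Aᵀ * B).trace

theorem finner_eq_sum {p q : ℕ} (A B : Matrix (Fin p) (Fin q) ℝ) :
    finner A B = ∑ i, ∑ j, A i j * B i j := by
  simp only [finner, Matrix.trace, Matrix.diag_apply, Matrix.mul_apply, Matrix.transpose_apply]
  exact Finset.sum_comm

theorem frobenius_norm_sq_eq_finner {p q : ℕ} (A : Matrix (Fin p) (Fin q) ℝ) :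
    ‖A‖ ^ 2 = finner A A := by
  rw [finner_eq_sum, Matrix.frobenius_norm_def, ← Real.sqrt_eq_rpow, Real.sq_sqrt (by positivity)]
  simp [pow_two]

theorem hasDerivAt_entry {p q : ℕ} {f : ℝ → Matrix (Fin p) (Fin q) ℝ}
    {f' : Matrix (Fin p) (Fin q) ℝ} {t : ℝ} (hf : HasDerivAt f f' t) (i : Fin p) (j : Fin q) :
    HasDerivAt (fun s => f s i j) (f' i j) t :=
  (LinearMap.toContinuousLinearMap (Matrix.entryLinearMap ℝ ℝ i j)).hasFDerivAt.comp_hasDerivAt t hf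

theorem hasDerivAt_frobenius_norm_sq {p q : ℕ} {f : ℝ → Matrix (Fin p) (Fin q) ℝ}
    {f' : Matrix (Fin p) (Fin q) ℝ} {t : ℝ} (hf : HasDerivAt f f' t) :
    HasDerivAt (fun s => ‖f s‖ ^ 2) (2 * finner (f t) f') t := by
  simp only [frobenius_norm_sq_eq_finner, finner_eq_sum, Finset.mul_sum]
  refine HasDerivAt.fun_sum fun i _ => HasDerivAt.fun_sum fun j _ => ?_
  refine ((hasDerivAt_entry hf i j).fun_mul (hasDerivAt_entry hf i j)).congr_deriv ?_
  ring

theorem finner_mul_eq_finner_transpose_mul {n m k : ℕ} (G : Matrix (Fin n) (Fin m) ℝ)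
    (P : Matrix (Fin n) (Fin k) ℝ) (M : Matrix (Fin k) (Fin m) ℝ) :
    finner G (P * M) = finner M (Pᵀ * G) := by
  rw [finner, finner, ← Matrix.trace_transpose]
  simp [Matrix.mul_assoc]

/-- **Momentum with online subspace descent is Hamiltonian descent.**
For differentiable `L : ℝ^{n×m} → ℝ` with gradient `∇L` (w.r.t. the Frobenius inner
product), `a > 0`, an arbitrary projection curve `P : ℝ → ℝ^{n×k}`, and curves
`W, m̂` solving `W' = −P m̂`, `m̂' = a(Pᵀ ∇L(W) − m̂)`, the Hamiltonian
`H(W, m̂) = L(W) + ‖m̂‖²/(2a)` satisfies `d/dt H(W t, m̂ t) = −‖m̂ t‖² ≤ 0`. -/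
theorem momentum_online_subspace_descent
    {n m k : ℕ} (hn : 0 < n) (hm : 0 < m) (hk : 0 < k)
    (L : Matrix (Fin n) (Fin m) ℝ → ℝ) (hL : Differentiable ℝ L)
    (gradL : Matrix (Fin n) (Fin m) ℝ → Matrix (Fin n) (Fin m) ℝ)
    (hgradL : ∀ W X : Matrix (Fin n) (Fin m) ℝ, fderiv ℝ L W X = finner (gradL W) X)
    (a : ℝ) (ha : 0 < a)
    (P : ℝ → Matrix (Fin n) (Fin k) ℝ)
    (W : ℝ → Matrix (Fin n) (Fin m) ℝ) (mh : ℝ → Matrix (Fin k) (Fin m) ℝ)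
    (hW : ∀ t : ℝ, HasDerivAt W (-(P t * mh t)) t)
    (hmh : ∀ t : ℝ, HasDerivAt mh (a • ((P t)ᵀ * gradL (W t) - mh t)) t) :
    ∀ t : ℝ,
      HasDerivAt (fun s : ℝ => L (W s) + ‖mh s‖ ^ 2 / (2 * a)) (-‖mh t‖ ^ 2) t ∧
      -‖mh t‖ ^ 2 ≤ 0 := by
  intro t
  refine ⟨?_, neg_nonpos.mpr (sq_nonneg _)⟩
  have hLW : HasDerivAt (fun s => L (W s)) (finner (gradL (W t)) (-(P t * mh t))) t :=
    ((hL (W t)).hasFDerivAt.comp_hasDerivAt t (hW t)).congr_deriv (hgradL _ _)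
  refine (hLW.add ((hasDerivAt_frobenius_norm_sq (hmh t)).div_const (2 * a))).congr_deriv ?_
  have hneg : finner (gradL (W t)) (-(P t * mh t)) = -finner (mh t) ((P t)ᵀ * gradL (W t)) := by
    rw [← finner_mul_eq_finner_transpose_mul]
    simp [finner]
  have hforce : finner (mh t) (a • ((P t)ᵀ * gradL (W t) - mh t)) =
      a * (finner (mh t) ((P t)ᵀ * gradL (W t)) - finner (mh t) (mh t)) := by
    simp [finner, Matrix.mul_sub]
  rw [hneg, hforce, frobenius_norm_sq_eq_finner]
  field_simp
  ring

end Stmt5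
end

section
/- Let n, m, k be positive integers, let L : ℝ^{n×m} → ℝ be differentiable, and let a, b, e > 0 with a ≥ b/4. Let P : ℝ → ℝ^{n×k} be an arbitrary function, and suppose w : ℝ → ℝ^{n×m} and m̂, v̂ : ℝ → ℝ^{k×m} are differentiable curves with all entries of v̂(t) strictly positive, satisfying the Adam-with-online-subspace-descent dynamics: w'(t) = −P(t)·(m̂(t)/(√(v̂(t)) + e)), m̂'(t) = a(ĝ(t) − m̂(t)), and v̂'(t) = b(ĝ(t)^{⊙2} − v̂(t)), where ĝ(t) = P(t)ᵀ·∇L(w(t)) and all operations on the entries of m̂, v̂, ĝ (square, square root, division, adding the scalar e) are elementwise. Define H(w, m̂, v̂) = L(w) + (1/(2a)) Σ_{ij} m̂_{ij}²/(√(v̂_{ij}) + e). Then for all t, (d/dt) H(w(t), m̂(t), v̂(t)) ≤ −(1 − b/(4a)) Σ_{ij} m̂_{ij}²/(√(v̂_{ij}) + e) − (b/(4a)) Σ_{ij} m̂_{ij}² ĝ_{ij}² / (√(v̂_{ij}) (√(v̂_{ij}) + e)²) ≤ 0, where m̂, v̂, ĝ are evaluated at time t. -/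
namespace Stmt6

open Matrix

attribute [local instance] Matrix.frobeniusNormedAddCommGroup Matrix.frobeniusNormedSpace

/-- Frobenius inner product `⟨A, B⟩ = trace(Aᵀ B)` of real matrices. -/
def finner {p q : ℕ} (A B : Matrix (Fin p) (Fin q) ℝ) : ℝ := (Aᵀ * B).trace

theorem hasDerivAt_matrix_entry {p q : ℕ} {M : ℝ → Matrix (Fin p) (Fin q) ℝ}
    {M' : Matrix (Fin p) (Fin q) ℝ} {t : ℝ} (h : HasDerivAt M M' t) (i : Fin p) (j : Fin q) :
    HasDerivAt (fun s => M s i j) (M' i j) t :=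
  (LinearMap.toContinuousLinearMap (Matrix.entryLinearMap ℝ ℝ i j)).hasFDerivAt.comp_hasDerivAt t h

theorem finner_mul_right {p q r : ℕ} (G : Matrix (Fin p) (Fin q) ℝ)
    (A : Matrix (Fin p) (Fin r) ℝ) (X : Matrix (Fin r) (Fin q) ℝ) :
    finner G (A * X) = finner (Aᵀ * G) X := by
  simp [finner, Matrix.transpose_mul, Matrix.mul_assoc]

theorem finner_eq_sum {p q : ℕ} (A B : Matrix (Fin p) (Fin q) ℝ) :
    finner A B = ∑ i, ∑ j, A i j * B i j := by
  simp only [finner, Matrix.trace, Matrix.diag_apply, Matrix.mul_apply, Matrix.transpose_apply]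
  exact Finset.sum_comm

theorem hasDerivAt_sq_div_sqrt_add {e : ℝ} (he : 0 < e) {x v : ℝ → ℝ} {x' v' t : ℝ}
    (hx : HasDerivAt x x' t) (hv : HasDerivAt v v' t) (hpos : 0 < v t) :
    HasDerivAt (fun s => x s ^ 2 / (√(v s) + e))
      (2 * x t * x' / (√(v t) + e) - x t ^ 2 * v' / (2 * √(v t) * (√(v t) + e) ^ 2)) t := by
  have hs : 0 < √(v t) := Real.sqrt_pos.2 hpos
  have hD : √(v t) + e ≠ 0 := by positivity
  refine ((hx.fun_pow 2).fun_div ((hv.sqrt hpos.ne').add_const e) hD).congr_deriv ?_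
  field_simp
  ring

theorem adam_entry_derivative_le {a b e x g v : ℝ} (ha : 0 < a) (hb : 0 < b) (he : 0 < e)
    (hv : 0 < v) :
    -(g * (x / (√v + e))) + 1 / (2 * a) *
        (2 * x * (a * (g - x)) / (√v + e)
          - x ^ 2 * (b * (g ^ 2 - v)) / (2 * √v * (√v + e) ^ 2)) ≤
      -(1 - b / (4 * a)) * (x ^ 2 / (√v + e))
        - b / (4 * a) * (x ^ 2 * g ^ 2 / (√v * (√v + e) ^ 2)) := by
  obtain ⟨s, hs, rfl⟩ : ∃ s, 0 < s ∧ v = s ^ 2 :=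
    ⟨√v, Real.sqrt_pos.2 hv, (Real.sq_sqrt hv.le).symm⟩
  rw [Real.sqrt_sq hs.le]
  have hD : 0 < s + e := by positivity
  rw [← sub_nonneg]
  have key : 0 ≤ b * e * x ^ 2 / (4 * a * (s + e) ^ 2) := by positivity
  convert key using 1
  field_simp
  ring

/-- **Adam with online subspace descent is Hamiltonian descent.**
For differentiable `L : ℝ^{n×m} → ℝ` with Frobenius gradient `∇L`, constants
`a, b, e > 0` with `a ≥ b/4`, an arbitrary projection curve `P : ℝ → ℝ^{n×k}` and
curves `w, m̂, v̂` (with `v̂ > 0` entrywise) solving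
`w' = −P (m̂/(√v̂+e))`, `m̂' = a(ĝ − m̂)`, `v̂' = b(ĝ^{⊙2} − v̂)` with `ĝ = Pᵀ ∇L(w)`
(all operations elementwise), the Hamiltonian
`H = L(w) + (1/(2a)) Σ_{ij} m̂_{ij}²/(√v̂_{ij}+e)` satisfies
`d/dt H ≤ −(1−b/(4a)) Σ_{ij} m̂_{ij}²/(√v̂_{ij}+e)
        − (b/(4a)) Σ_{ij} m̂_{ij}² ĝ_{ij}²/(√v̂_{ij}(√v̂_{ij}+e)²) ≤ 0`. -/
theorem adam_online_subspace_descent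
    {n m k : ℕ} (hn : 0 < n) (hm : 0 < m) (hk : 0 < k)
    (L : Matrix (Fin n) (Fin m) ℝ → ℝ) (hL : Differentiable ℝ L)
    (gradL : Matrix (Fin n) (Fin m) ℝ → Matrix (Fin n) (Fin m) ℝ)
    (hgradL : ∀ W X : Matrix (Fin n) (Fin m) ℝ, fderiv ℝ L W X = finner (gradL W) X)
    (a b e : ℝ) (ha : 0 < a) (hb : 0 < b) (he : 0 < e) (hab : b / 4 ≤ a)
    (P : ℝ → Matrix (Fin n) (Fin k) ℝ)
    (w : ℝ → Matrix (Fin n) (Fin m) ℝ)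
    (mh vh : ℝ → Matrix (Fin k) (Fin m) ℝ)
    (gh : ℝ → Matrix (Fin k) (Fin m) ℝ)
    (hgh : ∀ t : ℝ, gh t = (P t)ᵀ * gradL (w t))
    (hvpos : ∀ (t : ℝ) (i : Fin k) (j : Fin m), 0 < vh t i j)
    (hw : ∀ t : ℝ, HasDerivAt w
      (-(P t * Matrix.of fun i j => mh t i j / (Real.sqrt (vh t i j) + e))) t)
    (hmh : ∀ t : ℝ, HasDerivAt mh (a • (gh t - mh t)) t)
    (hvh : ∀ t : ℝ, HasDerivAt vh
      (b • ((Matrix.of fun i j => (gh t i j) ^ 2) - vh t)) t) :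
    ∀ t : ℝ,
      ∃ d : ℝ,
        HasDerivAt
          (fun s : ℝ =>
            L (w s) + (1 / (2 * a)) *
              ∑ i, ∑ j, (mh s i j) ^ 2 / (Real.sqrt (vh s i j) + e)) d t ∧
        d ≤ -(1 - b / (4 * a)) * (∑ i, ∑ j, (mh t i j) ^ 2 / (Real.sqrt (vh t i j) + e))
              - (b / (4 * a)) * (∑ i, ∑ j, (mh t i j) ^ 2 * (gh t i j) ^ 2
                  / (Real.sqrt (vh t i j) * (Real.sqrt (vh t i j) + e) ^ 2)) ∧
        -(1 - b / (4 * a)) * (∑ i, ∑ j, (mh t i j) ^ 2 / (Real.sqrt (vh t i j) + e))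
              - (b / (4 * a)) * (∑ i, ∑ j, (mh t i j) ^ 2 * (gh t i j) ^ 2
                  / (Real.sqrt (vh t i j) * (Real.sqrt (vh t i j) + e) ^ 2)) ≤ 0 := by
  intro t
  have hentry (i : Fin k) (j : Fin m) := hasDerivAt_sq_div_sqrt_add he
    (hasDerivAt_matrix_entry (hmh t) i j) (hasDerivAt_matrix_entry (hvh t) i j) (hvpos t i j)
  have hLw : HasDerivAt (fun s => L (w s)) (finner (gradL (w t))
      (-(P t * Matrix.of fun i j => mh t i j / (√(vh t i j) + e)))) t := by
    rw [← hgradL]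
    exact (hL (w t)).hasFDerivAt.comp_hasDerivAt t (hw t)
  rw [← Matrix.mul_neg, finner_mul_right, ← hgh, finner_eq_sum] at hLw
  have hsum := HasDerivAt.fun_sum (u := Finset.univ) fun i _ =>
    HasDerivAt.fun_sum (u := Finset.univ) fun j _ => hentry i j
  refine ⟨_, hLw.add (hsum.const_mul (1 / (2 * a))), ?_, ?_⟩
  · simp only [Finset.mul_sum, ← Finset.sum_add_distrib, ← Finset.sum_sub_distrib]
    refine Finset.sum_le_sum fun i _ => Finset.sum_le_sum fun j _ => ?_
    simpa using adam_entry_derivative_le (x := mh t i j) (g := gh t i j) ha hb he (hvpos t i j)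
  · have hcoef : 0 ≤ 1 - b / (4 * a) := by
      rw [sub_nonneg, div_le_one (by positivity)]
      linarith
    have hkin : 0 ≤ ∑ i, ∑ j, (mh t i j) ^ 2 / (√(vh t i j) + e) :=
      Finset.sum_nonneg fun i _ => Finset.sum_nonneg fun j _ => by positivity
    have hdiss : 0 ≤ b / (4 * a) * ∑ i, ∑ j, (mh t i j) ^ 2 * (gh t i j) ^ 2
        / (√(vh t i j) * (√(vh t i j) + e) ^ 2) :=
      mul_nonneg (by positivity)
        (Finset.sum_nonneg fun i _ => Finset.sum_nonneg fun j _ => by positivity)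
    linarith [mul_nonneg hcoef hkin]

end Stmt6
end

section
/- Let n, m, k be positive integers, let L : ℝ^{n×m} → ℝ be differentiable, let K : ℝ^{k×m} → ℝ be convex and differentiable with ∇K(0) = 0, let a ≥ 0 and b ∈ [0, 1). Let P : ℝ → ℝ^{n×k} be an arbitrary function, and suppose W : ℝ → ℝ^{n×m} and M̂ : ℝ → ℝ^{k×m} are differentiable curves satisfying the Lion-K-with-online-subspace-descent dynamics W'(t) = P(t)·∇K((1−b)M̂(t) − b·Ĝ(t)) and M̂'(t) = −a(Ĝ(t) + M̂(t)), where Ĝ(t) = P(t)ᵀ·∇L(W(t)). Define H(W, M̂) = a·L(W) + (1/(1−b))·K((1−b)M̂). Then for all t, (d/dt) H(W(t), M̂(t)) ≤ 0. -/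
namespace Stmt7

open Matrix

attribute [local instance] Matrix.frobeniusNormedAddCommGroup Matrix.frobeniusNormedSpace

/-- Frobenius inner product `⟨A, B⟩ = trace(Aᵀ B)` of real matrices. -/
def finner {p q : ℕ} (A B : Matrix (Fin p) (Fin q) ℝ) : ℝ := (Aᵀ * B).trace

theorem finner_comm {p q : ℕ} (A B : Matrix (Fin p) (Fin q) ℝ) : finner A B = finner B A := by
  unfold finner
  rw [← trace_transpose, transpose_mul, transpose_transpose]

theorem finner_sub_left {p q : ℕ} (A B C : Matrix (Fin p) (Fin q) ℝ) :
    finner (A - B) C = finner A C - finner B C := by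
  simp [finner, Matrix.sub_mul]

theorem finner_add_right {p q : ℕ} (A B C : Matrix (Fin p) (Fin q) ℝ) :
    finner A (B + C) = finner A B + finner A C := by
  simp [finner, Matrix.mul_add]

theorem finner_smul_right {p q : ℕ} (c : ℝ) (A B : Matrix (Fin p) (Fin q) ℝ) :
    finner A (c • B) = c * finner A B := by
  simp [finner]

theorem finner_neg_right {p q : ℕ} (A B : Matrix (Fin p) (Fin q) ℝ) :
    finner A (-B) = -finner A B := by
  simp [finner]

theorem finner_mul_right {p q r : ℕ} (A : Matrix (Fin p) (Fin q) ℝ)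
    (P : Matrix (Fin p) (Fin r) ℝ) (B : Matrix (Fin r) (Fin q) ℝ) :
    finner A (P * B) = finner (Pᵀ * A) B := by
  simp [finner, transpose_mul, Matrix.mul_assoc]

/-- The derivative of a convex differentiable function is a monotone operator. -/
theorem _root_.ConvexOn.fderiv_sub_apply_nonneg {E : Type*} [NormedAddCommGroup E]
    [NormedSpace ℝ E] {f : E → ℝ} (hf : ConvexOn ℝ Set.univ f) (hd : Differentiable ℝ f)
    (x y : E) : 0 ≤ fderiv ℝ f y (y - x) - fderiv ℝ f x (y - x) := by
  have hg : ConvexOn ℝ Set.univ (f ∘ AffineMap.lineMap (k := ℝ) x y) := by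
    simpa using hf.comp_affineMap (AffineMap.lineMap (k := ℝ) x y)
  have hder (s : ℝ) : HasDerivAt (f ∘ AffineMap.lineMap (k := ℝ) x y)
      (fderiv ℝ f (AffineMap.lineMap x y s) (y - x)) s :=
    (hd _).hasFDerivAt.comp_hasDerivAt s AffineMap.hasDerivAt_lineMap
  have hmono := hg.monotoneOn_deriv (fun s _ => (hder s).differentiableAt)
    (Set.mem_univ 0) (Set.mem_univ 1) zero_le_one
  rw [(hder 0).deriv, (hder 1).deriv] at hmono
  simpa using hmono

/-- **Lion-𝒦 with online subspace descent is Hamiltonian descent.**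
For differentiable `L : ℝ^{n×m} → ℝ` with Frobenius gradient `∇L`, convex differentiable
`K : ℝ^{k×m} → ℝ` with Frobenius gradient `∇K` and `∇K(0) = 0`, `a ≥ 0`, `b ∈ [0,1)`,
an arbitrary projection curve `P : ℝ → ℝ^{n×k}`, and curves `W, M̂` solving
`W' = P ∇K((1−b)M̂ − b Ĝ)`, `M̂' = −a(Ĝ + M̂)` with `Ĝ = Pᵀ ∇L(W)`, the Hamiltonian
`H(W, M̂) = a L(W) + K((1−b)M̂)/(1−b)` satisfies `d/dt H(W t, M̂ t) ≤ 0`. -/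
theorem lionK_online_subspace_descent
    {n m k : ℕ} (hn : 0 < n) (hm : 0 < m) (hk : 0 < k)
    (L : Matrix (Fin n) (Fin m) ℝ → ℝ) (hL : Differentiable ℝ L)
    (gradL : Matrix (Fin n) (Fin m) ℝ → Matrix (Fin n) (Fin m) ℝ)
    (hgradL : ∀ W X : Matrix (Fin n) (Fin m) ℝ, fderiv ℝ L W X = finner (gradL W) X)
    (K : Matrix (Fin k) (Fin m) ℝ → ℝ)
    (hKconv : ConvexOn ℝ Set.univ K) (hKdiff : Differentiable ℝ K)
    (gradK : Matrix (Fin k) (Fin m) ℝ → Matrix (Fin k) (Fin m) ℝ)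
    (hgradK : ∀ M X : Matrix (Fin k) (Fin m) ℝ, fderiv ℝ K M X = finner (gradK M) X)
    (hK0 : gradK 0 = 0)
    (a b : ℝ) (ha : 0 ≤ a) (hb0 : 0 ≤ b) (hb1 : b < 1)
    (P : ℝ → Matrix (Fin n) (Fin k) ℝ)
    (W : ℝ → Matrix (Fin n) (Fin m) ℝ) (Mh : ℝ → Matrix (Fin k) (Fin m) ℝ)
    (Gh : ℝ → Matrix (Fin k) (Fin m) ℝ)
    (hGh : ∀ t : ℝ, Gh t = (P t)ᵀ * gradL (W t))
    (hW : ∀ t : ℝ, HasDerivAt W (P t * gradK ((1 - b) • Mh t - b • Gh t)) t)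
    (hM : ∀ t : ℝ, HasDerivAt Mh (-(a • (Gh t + Mh t))) t) :
    ∀ t : ℝ,
      ∃ d : ℝ,
        HasDerivAt (fun s : ℝ => a * L (W s) + (1 / (1 - b)) * K ((1 - b) • Mh s)) d t ∧
        d ≤ 0 := by
  intro t
  have hc : 0 < 1 - b := sub_pos.mpr hb1
  have hmono (x y : Matrix (Fin k) (Fin m) ℝ) : 0 ≤ finner (gradK y - gradK x) (y - x) := by
    rw [finner_sub_left, ← hgradK, ← hgradK]
    exact hKconv.fderiv_sub_apply_nonneg hKdiff x y
  have hLW : HasDerivAt (fun s => L (W s))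
      (finner (gradL (W t)) (P t * gradK ((1 - b) • Mh t - b • Gh t))) t :=
    ((hL (W t)).hasFDerivAt.comp_hasDerivAt t (hW t)).congr_deriv (hgradL _ _)
  have hKM : HasDerivAt (fun s => K ((1 - b) • Mh s))
      (finner (gradK ((1 - b) • Mh t)) ((1 - b) • -(a • (Gh t + Mh t)))) t :=
    ((hKdiff ((1 - b) • Mh t)).hasFDerivAt.comp_hasDerivAt t
      ((hM t).const_smul (1 - b))).congr_deriv (hgradK _ _)
  refine ⟨_, (hLW.const_mul a).add (hKM.const_mul (1 / (1 - b))), ?_⟩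
  set v := (1 - b) • Mh t with hv
  set u := v - b • Gh t with hu
  rw [finner_mul_right, ← hGh, finner_smul_right, finner_neg_right,
    finner_smul_right, finner_add_right, finner_comm (Gh t)]
  have hvM : 0 ≤ finner (gradK v) (Mh t) := by
    have h := hmono 0 v
    rw [hK0, sub_zero, sub_zero, hv, finner_smul_right, ← hv] at h
    exact nonneg_of_mul_nonneg_right h hc
  have hGuv : finner (gradK u) (Gh t) ≤ finner (gradK v) (Gh t) := by
    rcases hb0.eq_or_lt with rfl | hb
    · simp [hu]
    · have h := hmono u v
      rw [hu, sub_sub_cancel, ← hu, finner_smul_right, finner_sub_left] at h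
      exact sub_nonneg.mp (nonneg_of_mul_nonneg_right h hb)
  have hd : a * finner (gradK u) (Gh t) + 1 / (1 - b) *
      ((1 - b) * -(a * (finner (gradK v) (Gh t) + finner (gradK v) (Mh t)))) =
      -(a * (finner (gradK v) (Gh t) - finner (gradK u) (Gh t) + finner (gradK v) (Mh t))) := by
    field_simp
    ring
  rw [hd]
  exact neg_nonpos.mpr (mul_nonneg ha (add_nonneg (sub_nonneg.mpr hGuv) hvM))

end Stmt7
end

section
/- Let E be a finite-dimensional real inner product space, let K : E → ℝ be differentiable with ∇K(0) = 0, let L : E → ℝ be differentiable, let a ≥ 0 and b ∈ (0, 1), and define the bilinear-type bracket [X; Y]_{∇K} = ⟨Y, ∇K(X + Y) − ∇K(X)⟩ for X, Y ∈ E. Let P : ℝ → Hom(F, E) be replaced concretely as follows: suppose W : ℝ → ℝ^{n×m} and M̂ : ℝ → ℝ^{k×m} are differentiable, P : ℝ → ℝ^{n×k} is arbitrary, K : ℝ^{k×m} → ℝ is differentiable with ∇K(0) = 0, and the curves satisfy W'(t) = P(t)·∇K((1−b)M̂(t) − b·Ĝ(t)) and M̂'(t) = −a(Ĝ(t) + M̂(t))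 with Ĝ(t) = P(t)ᵀ·∇L(W(t)). Then with H(W, M̂) = a·L(W) + (1/(1−b))·K((1−b)M̂), for all t: (d/dt) H(W(t), M̂(t)) = −(a/b)·[(1−b)M̂(t); −b·Ĝ(t)]_{∇K} − (a/(1−b))·[0; (1−b)M̂(t)]_{∇K}. -/
namespace Stmt8

open Matrix

attribute [local instance] Matrix.frobeniusNormedAddCommGroup Matrix.frobeniusNormedSpace

/-- Frobenius inner product `⟨A, B⟩ = trace(Aᵀ B)` of real matrices. -/
def finner {p q : ℕ} (A B : Matrix (Fin p) (Fin q) ℝ) : ℝ := (Aᵀ * B).trace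

theorem finner_comm {p q : ℕ} (A B : Matrix (Fin p) (Fin q) ℝ) : finner A B = finner B A := by
  unfold finner
  rw [← trace_transpose, transpose_mul, transpose_transpose]

theorem finner_add_right {p q : ℕ} (A B C : Matrix (Fin p) (Fin q) ℝ) :
    finner A (B + C) = finner A B + finner A C := by
  simp [finner, Matrix.mul_add]

theorem finner_neg_right {p q : ℕ} (A B : Matrix (Fin p) (Fin q) ℝ) :
    finner A (-B) = -finner A B := by
  simp [finner]

theorem finner_sub_right {p q : ℕ} (A B C : Matrix (Fin p) (Fin q) ℝ) :
    finner A (B - C) = finner A B - finner A C := by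
  simp [finner, Matrix.mul_sub]

theorem finner_smul_right {p q : ℕ} (c : ℝ) (A B : Matrix (Fin p) (Fin q) ℝ) :
    finner A (c • B) = c * finner A B := by
  simp [finner]

theorem finner_neg_left {p q : ℕ} (A B : Matrix (Fin p) (Fin q) ℝ) :
    finner (-A) B = -finner A B := by
  simp [finner]

theorem finner_smul_left {p q : ℕ} (c : ℝ) (A B : Matrix (Fin p) (Fin q) ℝ) :
    finner (c • A) B = c * finner A B := by
  simp [finner]

/-- Left multiplication by `Pᵀ` is the Frobenius adjoint of left multiplication by `P`. -/
theorem finner_mul_right {p q r : ℕ} (A : Matrix (Fin p) (Fin q) ℝ)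
    (P : Matrix (Fin p) (Fin r) ℝ) (B : Matrix (Fin r) (Fin q) ℝ) :
    finner A (P * B) = finner (Pᵀ * A) B := by
  simp [finner, transpose_mul, Matrix.mul_assoc]

/-- **Exact dissipation identity for Lion-𝒦 with online subspace descent.**
For differentiable `L : ℝ^{n×m} → ℝ` and differentiable `K : ℝ^{k×m} → ℝ` with
Frobenius gradients `∇L`, `∇K` and `∇K(0) = 0`, `a ≥ 0`, `b ∈ (0,1)`, arbitrary
`P : ℝ → ℝ^{n×k}`, and curves solving `W' = P ∇K((1−b)M̂ − b Ĝ)`,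
`M̂' = −a(Ĝ + M̂)` with `Ĝ = Pᵀ ∇L(W)`, the Hamiltonian
`H(W, M̂) = a L(W) + K((1−b)M̂)/(1−b)` satisfies, with the bracket
`[X; Y]_{∇K} = ⟨Y, ∇K(X+Y) − ∇K(X)⟩`:
`d/dt H = −(a/b)[(1−b)M̂; −bĜ]_{∇K} − (a/(1−b))[0; (1−b)M̂]_{∇K}`. -/
theorem lionK_online_subspace_descent_identity
    {n m k : ℕ} (hn : 0 < n) (hm : 0 < m) (hk : 0 < k)
    (L : Matrix (Fin n) (Fin m) ℝ → ℝ) (hL : Differentiable ℝ L)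
    (gradL : Matrix (Fin n) (Fin m) ℝ → Matrix (Fin n) (Fin m) ℝ)
    (hgradL : ∀ W X : Matrix (Fin n) (Fin m) ℝ, fderiv ℝ L W X = finner (gradL W) X)
    (K : Matrix (Fin k) (Fin m) ℝ → ℝ) (hKdiff : Differentiable ℝ K)
    (gradK : Matrix (Fin k) (Fin m) ℝ → Matrix (Fin k) (Fin m) ℝ)
    (hgradK : ∀ M X : Matrix (Fin k) (Fin m) ℝ, fderiv ℝ K M X = finner (gradK M) X)
    (hK0 : gradK 0 = 0)
    (a b : ℝ) (ha : 0 ≤ a) (hb0 : 0 < b) (hb1 : b < 1)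
    -- the bracket `[X; Y]_{∇K} = ⟨Y, ∇K(X + Y) − ∇K(X)⟩`
    (br : Matrix (Fin k) (Fin m) ℝ → Matrix (Fin k) (Fin m) ℝ → ℝ)
    (hbr : ∀ X Y : Matrix (Fin k) (Fin m) ℝ, br X Y = finner Y (gradK (X + Y) - gradK X))
    (P : ℝ → Matrix (Fin n) (Fin k) ℝ)
    (W : ℝ → Matrix (Fin n) (Fin m) ℝ) (Mh : ℝ → Matrix (Fin k) (Fin m) ℝ)
    (Gh : ℝ → Matrix (Fin k) (Fin m) ℝ)
    (hGh : ∀ t : ℝ, Gh t = (P t)ᵀ * gradL (W t))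
    (hW : ∀ t : ℝ, HasDerivAt W (P t * gradK ((1 - b) • Mh t - b • Gh t)) t)
    (hM : ∀ t : ℝ, HasDerivAt Mh (-(a • (Gh t + Mh t))) t) :
    ∀ t : ℝ,
      HasDerivAt (fun s : ℝ => a * L (W s) + (1 / (1 - b)) * K ((1 - b) • Mh s))
        (-(a / b) * br ((1 - b) • Mh t) (-(b • Gh t))
          - (a / (1 - b)) * br 0 ((1 - b) • Mh t)) t := by
  intro t
  have hLW : HasDerivAt (fun s => L (W s))
      (finner (gradL (W t)) (P t * gradK ((1 - b) • Mh t - b • Gh t))) t :=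
    ((hL (W t)).hasFDerivAt.comp_hasDerivAt t (hW t)).congr_deriv (hgradL _ _)
  have hKM : HasDerivAt (fun s => K ((1 - b) • Mh s))
      (finner (gradK ((1 - b) • Mh t)) ((1 - b) • -(a • (Gh t + Mh t)))) t :=
    ((hKdiff ((1 - b) • Mh t)).hasFDerivAt.comp_hasDerivAt t
      ((hM t).const_smul (1 - b))).congr_deriv (hgradK _ _)
  rw [finner_mul_right, ← hGh] at hLW
  rw [finner_smul_right, finner_neg_right, finner_smul_right, finner_add_right] at hKM
  refine ((hLW.const_mul a).add (hKM.const_mul (1 / (1 - b)))).congr_deriv ?_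
  have hb : b ≠ 0 := hb0.ne'
  have hb' : 1 - b ≠ 0 := by linarith
  rw [hbr, hbr, zero_add, hK0, sub_zero, ← sub_eq_add_neg, finner_neg_left, finner_smul_left,
    finner_smul_left, finner_sub_right, finner_comm (gradK _) (Gh t),
    finner_comm (gradK _) (Mh t)]
  field_simp
  ring

end Stmt8
end
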